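/- Let ζ̄(x,R) = √x·R + (1/√x)·ln R for x > 0 and R > 0, and fix a > 0 and η with 0 < η < a. Define F_R(z) = e^{i(ζ̄(z,R) − ζ̄(a,R))}/(z − a) using the principal branch of √z and ln on the right half-plane. Then lim_{R→∞} ∫_{a−η}^{a} sin(ζ̄(x,R) − ζ̄(a,R))/(π(x−a)) dx = 1/2. -/

import Mathlib

open MeasureTheory Filter Real

/-- The real phase function ζ̄(x,R) = √x·R + (ln R)/√x. -/
noncomputable def zetaBar (x R : ℝ) : ℝ :=
  Real.sqrt x * R + Real.log R / Real.sqrt x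


lemma aux_inner (T y : ℝ) :
    ∫ x in (0:ℝ)..T, sin x * exp (-x * y)
      = (1 + y ^ 2)⁻¹ - exp (-T * y) * (y * sin T + cos T) / (1 + y ^ 2) := by
  have h1 : (1 + y ^ 2) ≠ 0 := by positivity
  rw [intervalIntegral.integral_eq_sub_of_hasDerivAt
    (f := fun x => -(exp (-x * y) * (y * sin x + cos x) / (1 + y ^ 2)))]
  · simp; field_simp; ring
  · intro x _
    have e1 : HasDerivAt (fun x : ℝ => exp (-x * y)) (exp (-x * y) * (-1 * y)) x :=
      (((hasDerivAt_id x).neg).mul_const y).exp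
    have e2 : HasDerivAt (fun x : ℝ => y * sin x + cos x) (y * cos x + -sin x) x :=
      ((hasDerivAt_sin x).const_mul y).add (hasDerivAt_cos x)
    have e3 := ((e1.mul e2).div_const (1 + y ^ 2)).neg
    refine e3.congr_deriv ?_
    field_simp
    ring
  · exact (by fun_prop : Continuous fun x => sin x * exp (-x * y)).intervalIntegrable _ _

lemma aux_sinc {T : ℝ} (hT : 0 < T) :
    ∫ x in (0:ℝ)..T, sinc x = ∫ y in Set.Ioi (0:ℝ),
      ((1 + y ^ 2)⁻¹ - exp (-T * y) * (y * sin T + cos T) / (1 + y ^ 2)) := by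
  have hE : ∀ x : ℝ, 0 < x → ∫ y in Set.Ioi (0:ℝ), exp (-x * y) = 1 / x := by
    intro x hx
    rw [integral_exp_mul_Ioi (by linarith : -x < 0) 0]
    simp
  have hEi : ∀ x : ℝ, 0 < x → IntegrableOn (fun y => exp (-x * y)) (Set.Ioi (0:ℝ)) := by
    intro x hx
    exact integrableOn_exp_mul_Ioi (by linarith : -x < 0) 0
  have hint : Integrable (Function.uncurry fun x y : ℝ => sin x * exp (-x * y))
      ((volume.restrict (Set.Ioc 0 T)).prod (volume.restrict (Set.Ioi (0:ℝ)))) := by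
    rw [integrable_prod_iff]
    · constructor
      · filter_upwards [ae_restrict_mem measurableSet_Ioc] with x hx
        exact (hEi x hx.1).const_mul (sin x)
      · have : IntegrableOn (fun x => |sinc x|) (Set.Ioc 0 T) :=
          (continuous_sinc.abs.intervalIntegrable 0 T).1
        refine this.congr ?_
        filter_upwards [ae_restrict_mem measurableSet_Ioc] with x hx
        have : ∀ y : ℝ, ‖Function.uncurry (fun x y : ℝ => sin x * exp (-x * y)) (x, y)‖
            = |sin x| * exp (-x * y) := by
          intro y
          simp [Function.uncurry]
        simp_rw [this]
        rw [integral_const_mul, hE x hx.1, sinc_of_ne_zero hx.1.ne', abs_div, abs_of_pos hx.1]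
        ring
    · apply Continuous.aestronglyMeasurable
      simp only [Function.uncurry_def]
      fun_prop
  have key := integral_integral_swap hint
  rw [intervalIntegral.integral_of_le hT.le]
  trans ∫ x in Set.Ioc 0 T, ∫ y in Set.Ioi (0:ℝ), sin x * exp (-x * y)
  · refine setIntegral_congr_fun measurableSet_Ioc fun x hx => ?_
    rw [integral_const_mul, hE x hx.1, sinc_of_ne_zero hx.1.ne']
    ring
  · rw [key]
    refine integral_congr_ae (Eventually.of_forall fun y => ?_)
    simp only
    rw [← intervalIntegral.integral_of_le hT.le, aux_inner]

lemma aux_bound (T y : ℝ) : |exp (-T * y) * (y * sin T + cos T) / (1 + y ^ 2)| ≤ exp (-T * y) := by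
  have h1 : 0 < 1 + y ^ 2 := by positivity
  rw [abs_div, abs_of_pos h1, abs_mul, abs_of_pos (exp_pos _), div_le_iff₀ h1]
  gcongr
  apply abs_le_of_sq_le_sq _ h1.le
  nlinarith [sin_sq_add_cos_sq T, sq_nonneg (y * cos T - sin T), sq_nonneg y, sq_nonneg (y^2)]

lemma aux_dirichlet : Tendsto (fun T : ℝ => ∫ x in (0:ℝ)..T, sinc x) atTop (nhds (π / 2)) := by
  rw [tendsto_iff_norm_sub_tendsto_zero]
  refine squeeze_zero' (Eventually.of_forall fun _ => norm_nonneg _) ?_ tendsto_inv_atTop_zero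
  filter_upwards [eventually_gt_atTop 0] with T hT
  have hi : IntegrableOn (fun y => exp (-T * y)) (Set.Ioi (0:ℝ)) :=
    integrableOn_exp_mul_Ioi (by linarith : -T < 0) 0
  have hj : IntegrableOn (fun y => exp (-T * y) * (y * sin T + cos T) / (1 + y ^ 2))
      (Set.Ioi (0:ℝ)) := by
    refine hi.mono' ?_ (Eventually.of_forall fun y => aux_bound T y)
    apply Continuous.aestronglyMeasurable
    have : ∀ y : ℝ, 1 + y ^ 2 ≠ 0 := fun y => by positivity
    fun_prop (disch := assumption)
  rw [aux_sinc hT, integral_sub integrable_inv_one_add_sq.integrableOn hj,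
    integral_Ioi_inv_one_add_sq]
  simp only [arctan_zero, sub_zero, sub_sub_cancel_left, norm_neg]
  refine (norm_integral_le_of_norm_le hi (Eventually.of_forall fun y => aux_bound T y)).trans ?_
  rw [integral_exp_mul_Ioi (by linarith : -T < 0) 0]
  simp

/-- algebraic identity behind the splitting of the integrand -/
lemma aux_alg (s b R L S C : ℝ) (hs : 0 < s) (hsb : s < b) (hR : 0 < R)
    (hL : 0 < R * s * b - L) :
    S / (b ^ 2 - s ^ 2) =
      (-(S / ((b * R + L / b) - (s * R + L / s)) * (-(1 / (2 * s) * R) + L * (1 / (2 * s)) / s ^ 2))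
        - ((-S * (-(1 / (2 * s) * R) + L * (1 / (2 * s)) / s ^ 2) * (b + s) - C * (1 / (2 * s)))
            / (b + s) ^ 2) / R)
      + (S * L / (2 * s ^ 2 * (R * s * b - L)) - C / (2 * s * (b + s) ^ 2 * R)
        - L * S / (R * (2 * s ^ 3 * (b + s)))) := by
  have hb : 0 < b := hs.trans hsb
  have h1 : b - s ≠ 0 := by linarith
  have h2 : b + s ≠ 0 := by positivity
  have e1 : b ^ 2 - s ^ 2 = (b - s) * (b + s) := by ring
  have e2 : (b * R + L / b) - (s * R + L / s) = (b - s) * (R * s * b - L) / (s * b) := by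
    field_simp
    ring
  rw [e1, e2]
  have h3 := hL.ne'
  generalize hK : R * s * b - L = K at *
  obtain rfl : L = R * s * b - K := by linarith
  field_simp
  ring

lemma aux_Ebound (s b m R L S C : ℝ) (hm : 0 < m) (hs : m ≤ s) (hsb : m ≤ b) (hR : 0 < R)
    (hL0 : 0 ≤ L) (hL : L ≤ R * m ^ 2 / 2) (hS : |S| ≤ 1) (hC : |C| ≤ 1) :
    ‖S * L / (2 * s ^ 2 * (R * s * b - L)) - C / (2 * s * (b + s) ^ 2 * R)
        - L * S / (R * (2 * s ^ 3 * (b + s)))‖ ≤ 2 / m ^ 4 * (L / R) + 1 / m ^ 3 * R⁻¹ := by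
  have hs0 : 0 < s := hm.trans_le hs
  have hb0 : 0 < b := hm.trans_le hsb
  have k0 : R * m ^ 2 ≤ R * s * b := by
    have : m * m ≤ s * b := by gcongr
    nlinarith
  have k1 : R * m ^ 2 / 2 ≤ R * s * b - L := by linarith
  have k2 : 0 < R * s * b - L := lt_of_lt_of_le (by positivity) k1
  have t1 : |S * L / (2 * s ^ 2 * (R * s * b - L))| ≤ 1 / m ^ 4 * (L / R) := by
    rw [abs_div, abs_mul, abs_of_nonneg hL0, abs_of_pos (by positivity : 0 < 2 * s ^ 2 * (R * s * b - L))]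
    calc |S| * L / (2 * s ^ 2 * (R * s * b - L)) ≤ 1 * L / (2 * m ^ 2 * (R * m ^ 2 / 2)) := by
          gcongr
      _ = 1 / m ^ 4 * (L / R) := by field_simp
  have t2 : |C / (2 * s * (b + s) ^ 2 * R)| ≤ 1 / m ^ 3 * R⁻¹ := by
    rw [abs_div, abs_of_pos (by positivity : 0 < 2 * s * (b + s) ^ 2 * R)]
    calc |C| / (2 * s * (b + s) ^ 2 * R) ≤ 1 / (1 * m * (0 + m) ^ 2 * R) := by
          gcongr
          norm_num
      _ = 1 / m ^ 3 * R⁻¹ := by field_simp; ring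
  have t3 : |L * S / (R * (2 * s ^ 3 * (b + s)))| ≤ 1 / m ^ 4 * (L / R) := by
    rw [abs_div, abs_mul, abs_of_nonneg hL0, abs_of_pos (by positivity : 0 < R * (2 * s ^ 3 * (b + s)))]
    calc L * |S| / (R * (2 * s ^ 3 * (b + s))) ≤ L * 1 / (R * (1 * m ^ 3 * (0 + m))) := by
          gcongr
          norm_num
      _ = 1 / m ^ 4 * (L / R) := by field_simp; ring
  rw [Real.norm_eq_abs]
  have e : 2 / m ^ 4 * (L / R) + 1 / m ^ 3 * R⁻¹
      = 1 / m ^ 4 * (L / R) + 1 / m ^ 3 * R⁻¹ + 1 / m ^ 4 * (L / R) := by ring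
  rw [e]
  have u1 := abs_le.1 t1
  have u2 := abs_le.1 t2
  have u3 := abs_le.1 t3
  rw [abs_le]
  constructor <;> linarith [u1.1, u1.2, u2.1, u2.2, u3.1, u3.2]

lemma aux_main (a η : ℝ) (hη₁ : 0 < η) (hη₂ : η < a) (R : ℝ) (hR : 1 ≤ R)
    (hL : log R ≤ R * (a - η) / 2) :
    |π * (∫ x in (a - η)..a, Real.sin (zetaBar x R - zetaBar a R) / (π * (x - a)))
      - ∫ t in (0:ℝ)..(zetaBar a R - zetaBar (a - η) R), sinc t|
    ≤ 2 * (R⁻¹ * (√(a - η))⁻¹) +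
      (2 / √(a - η) ^ 4 * (log R / R) + 1 / √(a - η) ^ 3 * R⁻¹) * η := by
  have hR0 : 0 < R := by linarith
  have hc : 0 < a - η := by linarith
  have ha : 0 < a := by linarith
  have hlog : 0 ≤ log R := log_nonneg hR
  set m := √(a - η) with hmdef
  have hm : 0 < m := sqrt_pos.2 hc
  have hm2 : m ^ 2 = a - η := sq_sqrt hc.le
  set b := √a with hb
  have hb0 : 0 < b := sqrt_pos.2 ha
  have hmb : m ≤ b := sqrt_le_sqrt (by linarith)
  have hb2 : b ^ 2 = a := sq_sqrt ha.le
  set L := log R with hLdef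
  set θ : ℝ → ℝ := fun x => zetaBar a R - zetaBar x R with hθ
  set P : ℝ → ℝ := fun t => ∫ u in (0:ℝ)..t, sinc u with hP
  have hPd : ∀ t, HasDerivAt P (sinc t) t := fun t =>
    intervalIntegral.integral_hasDerivAt_right (continuous_sinc.intervalIntegrable _ _)
      (continuous_sinc.stronglyMeasurableAtFilter _ _) continuous_sinc.continuousAt
  set θ' : ℝ → ℝ := fun x => -(1 / (2 * √x) * R) + L * (1 / (2 * √x)) / √x ^ 2 with hθ'
  have hθd : ∀ x, 0 < x → HasDerivAt θ (θ' x) x := by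
    intro x hx
    have h1 := hasDerivAt_sqrt hx.ne'
    have hsx : √x ≠ 0 := (sqrt_pos.2 hx).ne'
    have h2 : HasDerivAt (fun x => zetaBar x R)
        (1 / (2 * √x) * R + (0 * √x - L * (1 / (2 * √x))) / √x ^ 2) x :=
      (h1.mul_const R).add ((hasDerivAt_const x L).div h1 hsx)
    refine (h2.const_sub (zetaBar a R)).congr_deriv ?_
    simp only [hθ']
    ring
  set ψ : ℝ → ℝ := fun x => -(sinc (θ x) * θ' x)
    - ((-sin (θ x) * θ' x * (b + √x) - cos (θ x) * (1 / (2 * √x))) / (b + √x) ^ 2) / R with hψ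
  set Ψ : ℝ → ℝ := fun x => -(P (θ x)) - (cos (θ x) / (b + √x)) / R with hΨ
  set E : ℝ → ℝ := fun x => sin (θ x) * L / (2 * √x ^ 2 * (R * √x * b - L))
    - cos (θ x) / (2 * √x * (b + √x) ^ 2 * R)
    - L * sin (θ x) / (R * (2 * √x ^ 3 * (b + √x))) with hE
  have hIcc : Set.uIcc (a - η) a = Set.Icc (a - η) a := Set.uIcc_of_le (by linarith)
  have hsx : ∀ x ∈ Set.Icc (a - η) a, m ≤ √x := fun x hx => sqrt_le_sqrt hx.1
  have hK : ∀ x ∈ Set.Icc (a - η) a, 0 < R * √x * b - L := by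
    intro x hx
    have : m * m ≤ √x * b := by
      have := hsx x hx
      gcongr
    have h3 : R * (a - η) ≤ R * (√x * b) := by
      rw [← hm2, pow_two]
      gcongr
    nlinarith [mul_pos hR0 hc]
  have hΨd : ∀ x ∈ Set.uIcc (a - η) a, HasDerivAt Ψ (ψ x) x := by
    intro x hx
    rw [hIcc] at hx
    have hx0 : 0 < x := hc.trans_le hx.1
    have h1 := hasDerivAt_sqrt hx0.ne'
    have hbs : b + √x ≠ 0 := by positivity
    have h2 := (hPd (θ x)).comp x (hθd x hx0)
    have h3 := ((hθd x hx0).cos.div (h1.const_add b) hbs).div_const R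
    exact h2.neg.sub h3
  have hθc : ContinuousOn θ (Set.Icc (a - η) a) := fun x hx =>
    (hθd x (hc.trans_le hx.1)).continuousAt.continuousWithinAt
  have hs0 : ∀ x ∈ Set.Icc (a - η) a, √x ≠ 0 := fun x hx => (hm.trans_le (hsx x hx)).ne'
  have hbs0 : ∀ x ∈ Set.Icc (a - η) a, b + √x ≠ 0 := fun x hx => by positivity
  have hsq : ContinuousOn (fun x : ℝ => √x) (Set.Icc (a - η) a) := continuous_sqrt.continuousOn
  have hinv : ContinuousOn (fun x : ℝ => 1 / (2 * √x)) (Set.Icc (a - η) a) :=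
    continuousOn_const.div (continuousOn_const.mul hsq)
      (fun x hx => mul_ne_zero two_ne_zero (hs0 x hx))
  have hθ'c : ContinuousOn θ' (Set.Icc (a - η) a) :=
    (hinv.mul continuousOn_const).neg.add ((continuousOn_const.mul hinv).div (hsq.pow 2)
      (fun x hx => pow_ne_zero 2 (hs0 x hx)))
  have hsin : ContinuousOn (fun x => sin (θ x)) (Set.Icc (a - η) a) :=
    continuous_sin.comp_continuousOn hθc
  have hcos : ContinuousOn (fun x => cos (θ x)) (Set.Icc (a - η) a) :=
    continuous_cos.comp_continuousOn hθc
  have hbs : ContinuousOn (fun x => b + √x) (Set.Icc (a - η) a) := continuousOn_const.add hsq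
  have hψc : ContinuousOn ψ (Set.Icc (a - η) a) := by
    refine ((continuous_sinc.comp_continuousOn hθc).mul hθ'c).neg.sub (ContinuousOn.div_const ?_ R)
    exact (((hsin.neg.mul hθ'c).mul hbs).sub (hcos.mul hinv)).div (hbs.pow 2)
      (fun x hx => pow_ne_zero 2 (hbs0 x hx))
  have hEc : ContinuousOn E (Set.Icc (a - η) a) := by
    refine ContinuousOn.sub (ContinuousOn.sub ?_ ?_) ?_
    · refine (hsin.mul continuousOn_const).div ((continuousOn_const.mul (hsq.pow 2)).mul
        (((continuousOn_const.mul hsq).mul continuousOn_const).sub continuousOn_const)) ?_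
      intro x hx
      exact mul_ne_zero (mul_ne_zero two_ne_zero (pow_ne_zero 2 (hs0 x hx))) (hK x hx).ne'
    · refine hcos.div (((continuousOn_const.mul hsq).mul (hbs.pow 2)).mul continuousOn_const) ?_
      intro x hx
      exact mul_ne_zero (mul_ne_zero (mul_ne_zero two_ne_zero (hs0 x hx))
        (pow_ne_zero 2 (hbs0 x hx))) hR0.ne'
    · refine (continuousOn_const.mul hsin).div (continuousOn_const.mul
        ((continuousOn_const.mul (hsq.pow 3)).mul hbs)) ?_
      intro x hx
      exact mul_ne_zero hR0.ne' (mul_ne_zero (mul_ne_zero two_ne_zero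
        (pow_ne_zero 3 (hs0 x hx))) (hbs0 x hx))
  have hψi : IntervalIntegrable ψ volume (a - η) a := (hIcc ▸ hψc).intervalIntegrable
  have hEi : IntervalIntegrable E volume (a - η) a := (hIcc ▸ hEc).intervalIntegrable
  have hpt : ∀ x ∈ Set.Icc (a - η) a, x ≠ a →
      π * (Real.sin (zetaBar x R - zetaBar a R) / (π * (x - a))) = ψ x + E x := by
    intro x hx hxa
    have hxlt : x < a := lt_of_le_of_ne hx.2 hxa
    have hx0 : 0 < x := hc.trans_le hx.1
    have hsp : 0 < √x := sqrt_pos.2 hx0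
    have hsb : √x < b := sqrt_lt_sqrt hx0.le hxlt
    have hθe : θ x = (b * R + L / b) - (√x * R + L / √x) := rfl
    have hθpos : 0 < θ x := by
      have e2 : (b * R + L / b) - (√x * R + L / √x)
          = (b - √x) * (R * √x * b - L) / (√x * b) := by
        field_simp
        ring
      rw [hθe, e2]
      have := hK x hx
      have : 0 < b - √x := by linarith
      positivity
    have := aux_alg (√x) b R L (sin (θ x)) (cos (θ x)) hsp hsb hR0 (hK x hx)
    rw [hb2, sq_sqrt hx0.le] at this
    have hl : π * (Real.sin (zetaBar x R - zetaBar a R) / (π * (x - a)))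
        = sin (θ x) / (a - x) := by
      have : zetaBar x R - zetaBar a R = -(θ x) := by simp [hθ]
      rw [this, sin_neg]
      have h1 : x - a ≠ 0 := by linarith
      have h2 : a - x ≠ 0 := by linarith
      have := pi_pos.ne'
      field_simp
      ring
    rw [hl, this]
    simp only [hψ, hE, hθ', sinc_of_ne_zero hθpos.ne']
    rw [sq_sqrt hx0.le, ← hθe]
  have hint : π * (∫ x in (a - η)..a, Real.sin (zetaBar x R - zetaBar a R) / (π * (x - a)))
      = (Ψ a - Ψ (a - η)) + ∫ x in (a - η)..a, E x := by
    rw [← intervalIntegral.integral_eq_sub_of_hasDerivAt hΨd hψi,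
      ← intervalIntegral.integral_add hψi hEi, ← intervalIntegral.integral_const_mul]
    refine intervalIntegral.integral_congr_ae ?_
    have : ∀ᵐ x : ℝ, x ≠ a := by simp [ae_iff]
    filter_upwards [this] with x hxa hx
    rw [Set.uIoc_of_le (by linarith)] at hx
    exact hpt x ⟨hx.1.le, hx.2⟩ hxa
  have hEb : ‖∫ x in (a - η)..a, E x‖ ≤ (2 / m ^ 4 * (L / R) + 1 / m ^ 3 * R⁻¹) * |a - (a - η)| := by
    refine intervalIntegral.norm_integral_le_of_norm_le_const fun x hx => ?_
    rw [Set.uIoc_of_le (by linarith)] at hx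
    exact aux_Ebound (√x) b m R L _ _ hm (hsx x ⟨hx.1.le, hx.2⟩) hmb hR0 hlog (by rw [hm2]; exact hL)
      (abs_sin_le_one _) (abs_cos_le_one _)
  have hθa : θ a = 0 := by simp [hθ]
  have hP0 : P 0 = 0 := by simp [hP]
  have hcb : ∀ x, |(cos (θ x) / (b + √x)) / R| ≤ R⁻¹ * m⁻¹ := by
    intro x
    have : 0 ≤ √x := sqrt_nonneg x
    rw [abs_div, abs_div, abs_of_pos hR0, abs_of_pos (by positivity : 0 < b + √x)]
    calc |cos (θ x)| / (b + √x) / R ≤ 1 / (m + 0) / R := by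
          gcongr
          exact abs_cos_le_one _
      _ = R⁻¹ * m⁻¹ := by field_simp; simp
  rw [hint]
  change |Ψ a - Ψ (a - η) + (∫ x in (a - η)..a, E x) - P (θ (a - η))| ≤ _
  have hab : |a - (a - η)| = η := by rw [sub_sub_cancel, abs_of_pos hη₁]
  rw [hab, Real.norm_eq_abs] at hEb
  simp only [hΨ, hθa, hP0]
  have q1 := abs_le.1 (hcb a)
  have q2 := abs_le.1 (hcb (a - η))
  have q3 := abs_le.1 hEb
  rw [hθa] at q1
  rw [abs_le]
  constructor <;> linarith [q1.1, q1.2, q2.1, q2.2, q3.1, q3.2]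

/-- The Dirichlet-type limit for the Coulomb phase obtained via contour
integration: lim_{R→∞} ∫_{a−η}^{a} sin(ζ̄(x,R) − ζ̄(a,R))/(π(x−a)) dx = 1/2. -/
theorem coulomb_phase_half_limit (a η : ℝ) (ha : 0 < a) (hη₁ : 0 < η) (hη₂ : η < a) :
    Tendsto (fun R : ℝ =>
        ∫ x in (a - η)..a, Real.sin (zetaBar x R - zetaBar a R) / (π * (x - a)))
      atTop (nhds (1/2)) := by
  have hc : 0 < a - η := by linarith
  have hLR : Tendsto (fun R : ℝ => log R / R) atTop (nhds 0) := by
    simpa using isLittleO_log_id_atTop.tendsto_div_nhds_zero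
  have hm : 0 < √(a - η) := sqrt_pos.2 hc
  have hmb : √(a - η) < √a := sqrt_lt_sqrt hc.le (by linarith)
  have hθ : Tendsto (fun R => zetaBar a R - zetaBar (a - η) R) atTop atTop := by
    have h1 : Tendsto (fun R : ℝ => (√a - √(a - η)) + (1 / √a - 1 / √(a - η)) * (log R / R)) atTop
        (nhds ((√a - √(a - η)) + (1 / √a - 1 / √(a - η)) * 0)) :=
      tendsto_const_nhds.add (hLR.const_mul _)
    have h2 := h1.pos_mul_atTop (by simpa using hmb) tendsto_id
    refine h2.congr' ?_
    filter_upwards [eventually_gt_atTop 0] with R hR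
    simp only [zetaBar, id]
    field_simp
    ring
  have hD := aux_dirichlet.comp hθ
  have hb : Tendsto (fun R : ℝ => 2 * (R⁻¹ * (√(a - η))⁻¹) +
      (2 / √(a - η) ^ 4 * (log R / R) + 1 / √(a - η) ^ 3 * R⁻¹) * η) atTop (nhds 0) := by
    have hi : Tendsto (fun R : ℝ => R⁻¹) atTop (nhds 0) := tendsto_inv_atTop_zero
    have := ((hi.mul_const (√(a - η))⁻¹).const_mul 2).add
      (((hLR.const_mul (2 / √(a - η) ^ 4)).add (hi.const_mul (1 / √(a - η) ^ 3))).mul_const η)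
    simp only [zero_mul, mul_zero, add_zero] at this
    exact this
  have hdiff := squeeze_zero_norm' (f := fun R : ℝ =>
      π * (∫ x in (a - η)..a, Real.sin (zetaBar x R - zetaBar a R) / (π * (x - a)))
      - ∫ t in (0:ℝ)..(zetaBar a R - zetaBar (a - η) R), sinc t) ?_ hb
  · have := (hdiff.add hD).const_mul (π⁻¹)
    have hpi := pi_pos.ne'
    have e : π⁻¹ * (0 + π / 2) = 1 / 2 := by field_simp; ring
    rw [e] at this
    refine this.congr fun R => ?_
    simp only [Function.comp]
    rw [sub_add_cancel, inv_mul_cancel_left₀ hpi]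
  · filter_upwards [eventually_ge_atTop 1, hLR.eventually (ge_mem_nhds (half_pos hc))] with R hR hL
    refine aux_main a η hη₁ hη₂ R hR ?_
    rw [div_le_iff₀ (by linarith)] at hL
    linarith
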